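/- arXiv:2005.11533 — 2 statements merged into one kernel-verified Lean document; each statement's English description precedes it below -/
import Mathlib

section
/- Let R be a Dedekind domain with field of fractions k, let Λ be an R-order, and let N be a finitely generated Λ-module that is R-torsion. Then the equality [N^∨] = −σ[N] holds in G₀(Λ^op), where N^∨ = Hom_R(N, k/R) regarded as a Λ^op-module. -/
/-- A bundled finitely generated module over a ring `R`. -/
structure FGMod (R : Type) [Ring R] : Type 1 where
  carrier : Type
  [isAddCommGroup : AddCommGroup carrier]
  [isModule : Module R carrier]
  [isFinite : Module.Finite R carrier]

attribute [instance] FGMod.isAddCommGroup FGMod.isModule FGMod.isFinite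

/-- The subgroup of relations defining the Grothendieck group `G₀(R)`:
one relation `[M] = [L] + [N]` for each short exact sequence `0 → L → M → N → 0`
of finitely generated `R`-modules. -/
def G0Rel (R : Type) [Ring R] : AddSubgroup (FreeAbelianGroup (FGMod R)) :=
  AddSubgroup.closure
    { x | ∃ (L M N : FGMod R) (f : L.carrier →ₗ[R] M.carrier)
            (g : M.carrier →ₗ[R] N.carrier),
        Function.Injective f ∧ Function.Surjective g ∧ Function.Exact f g ∧
        x = FreeAbelianGroup.of M - FreeAbelianGroup.of L - FreeAbelianGroup.of N }

/-- The Grothendieck group `G₀(R)` of the category of finitely generated `R`-modules. -/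
def G0 (R : Type) [Ring R] : Type 1 :=
  FreeAbelianGroup (FGMod R) ⧸ G0Rel R

instance (R : Type) [Ring R] : AddCommGroup (G0 R) :=
  QuotientAddGroup.Quotient.addCommGroup _

/-- The class `[M] ∈ G₀(R)` of a finitely generated `R`-module `M` (junk value `0` if `M` is
not finitely generated). -/
noncomputable def G0.cls (R : Type) [Ring R] (M : Type) [AddCommGroup M] [Module R M] :
    G0 R := by
  classical
  exact
    if h : Module.Finite R M then
      QuotientAddGroup.mk (FreeAbelianGroup.of (@FGMod.mk R _ M _ _ h))
    else 0

theorem G0.cls_eq_mk (T : Type) [Ring T] (M : Type) [AddCommGroup M] [Module T M]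
    [h : Module.Finite T M] :
    G0.cls T M = (QuotientAddGroup.mk (FreeAbelianGroup.of (FGMod.mk M)) :
      FreeAbelianGroup (FGMod T) ⧸ G0Rel T) :=
  dif_pos h

/-- A short exact sequence `0 → L → M → N → 0` of finitely generated modules gives
`[M] = [L] + [N]` in `G₀`. -/
theorem G0.cls_eq_add_of_exact {T : Type} [Ring T] {L M N : Type}
    [AddCommGroup L] [Module T L] [Module.Finite T L]
    [AddCommGroup M] [Module T M] [Module.Finite T M]
    [AddCommGroup N] [Module T N] [Module.Finite T N]
    (f : L →ₗ[T] M) (g : M →ₗ[T] N) (hf : Function.Injective f)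
    (hg : Function.Surjective g) (hfg : Function.Exact f g) :
    G0.cls T M = G0.cls T L + G0.cls T N := by
  rw [← sub_eq_zero, ← sub_sub, G0.cls_eq_mk, G0.cls_eq_mk, G0.cls_eq_mk]
  exact (QuotientAddGroup.eq_zero_iff (N := G0Rel T)
    (.of (.mk M) - .of (.mk L) - .of (.mk N))).mpr
    (AddSubgroup.subset_closure ⟨.mk L, .mk M, .mk N, f, g, hf, hg, hfg, rfl⟩)

/-- The right `Λ`-module structure `(φ · l) x = φ (l • x)` on `Hom_R(M, A)`. -/
abbrev homOpModule (R Λ M A : Type) [CommRing R] [Ring Λ] [Algebra R Λ]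
    [AddCommGroup M] [Module Λ M] [Module R M] [IsScalarTower R Λ M]
    [AddCommGroup A] [Module R A] : Module Λᵐᵒᵖ (M →ₗ[R] A) where
  smul l φ := φ ∘ₗ Algebra.lsmul R R M l.unop
  one_smul φ := by
    ext x
    change φ ((1 : Λ) • x) = φ x
    rw [one_smul]
  mul_smul a b φ := by
    ext x
    change φ ((b.unop * a.unop) • x) = φ (b.unop • a.unop • x)
    rw [mul_smul]
  smul_zero a := rfl
  smul_add a φ ψ := rfl
  add_smul a b φ := by
    ext x
    change φ ((a.unop + b.unop) • x) = φ (a.unop • x) + φ (b.unop • x)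
    rw [add_smul, map_add]
  zero_smul φ := by
    ext x
    change φ ((0 : Λ) • x) = 0
    rw [zero_smul, map_zero]

/-- `Hom_R(M, A)` is finitely generated over `Λᵐᵒᵖ` as soon as it is so over `R`. -/
theorem Module.Finite.op_of_hom {R Λ M A : Type} [CommRing R] [Ring Λ] [Algebra R Λ]
    [AddCommGroup M] [Module Λ M] [Module R M] [IsScalarTower R Λ M]
    [AddCommGroup A] [Module R A] [Module Λᵐᵒᵖ (M →ₗ[R] A)]
    (h : ∀ (l : Λ) (φ : M →ₗ[R] A) (x : M), (MulOpposite.op l • φ) x = φ (l • x))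
    [Module.Finite R (M →ₗ[R] A)] : Module.Finite Λᵐᵒᵖ (M →ₗ[R] A) := by
  have : IsScalarTower R Λᵐᵒᵖ (M →ₗ[R] A) := by
    refine ⟨fun r l φ => ?_⟩
    induction l using MulOpposite.rec' with | _ l =>
    ext x
    rw [← MulOpposite.op_smul, h, smul_assoc, map_smul, LinearMap.smul_apply, h]
  exact Module.Finite.of_restrictScalars_finite R Λᵐᵒᵖ _

/-- A finitely generated `Λ`-module all of whose elements are `R`-torsion is killed by a single
nonzero element of `R`. -/
theorem exists_ne_zero_smul_eq_zero {R Λ N : Type} [CommRing R] [IsDomain R] [Ring Λ]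
    [Algebra R Λ] [Module.Finite R Λ] [AddCommGroup N] [Module Λ N] [Module.Finite Λ N]
    [Module R N] [IsScalarTower R Λ N] (htors : ∀ x : N, ∃ r : R, r ≠ 0 ∧ r • x = 0) :
    ∃ r : R, r ≠ 0 ∧ ∀ x : N, r • x = 0 := by
  have : Module.Finite R N := Module.Finite.trans Λ N
  obtain ⟨s, hs⟩ := Module.Finite.fg_top (R := R) (M := N)
  choose c hc0 hc using htors
  refine ⟨∏ y ∈ s, c y, Finset.prod_ne_zero_iff.mpr fun y _ => hc0 y, fun x => ?_⟩
  have hx : x ∈ Submodule.span R (s : Set N) := hs ▸ Submodule.mem_top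
  induction hx using Submodule.span_induction with
  | mem y hy =>
    obtain ⟨d, hd⟩ := Finset.dvd_prod_of_mem c hy
    rw [hd, mul_comm, mul_smul, hc, smul_zero]
  | zero => rw [smul_zero]
  | add y z _ _ hy hz => rw [smul_add, hy, hz, add_zero]
  | smul a y _ hy => rw [smul_comm, hy, smul_zero]

/-- If `p : P → N` is a surjection with kernel `K` and `r ≠ 0` kills `N`, this is the
connecting map `Hom_R(K, R) → Hom_R(N, k/R)`. It extends `f : K → R` to `P → k` by
`x ↦ f (r • x) / r`, and passes to the quotient modulo `R`. -/
theorem exists_connecting {R k P N : Type} [CommRing R] [IsDomain R] [Field k] [Algebra R k]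
    [IsFractionRing R k] [AddCommGroup P] [Module R P] [AddCommGroup N] [Module R N]
    {K : Type} [AddCommGroup K] [Module R K] (i : K →ₗ[R] P) (hi : Function.Injective i)
    (p : P →ₗ[R] N) (hp : Function.Surjective p) (hip : Function.Exact i p)
    {r : R} (hr : r ≠ 0) (hN : ∀ x : N, r • x = 0) :
    ∃ δ : (K →ₗ[R] R) →ₗ[R] (N →ₗ[R] (k ⧸ LinearMap.range (Algebra.linearMap R k))),
      ∀ f x y, i y = r • x → δ f (p x) =
        Submodule.Quotient.mk ((algebraMap R k r)⁻¹ * algebraMap R k (f y)) := by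
  have hr' : algebraMap R k r ≠ 0 := by
    simpa using hr
  have hex (x : P) : ∃ y, i y = r • x := (hip _).mp (by rw [map_smul, hN])
  choose m hm using hex
  let s : P →ₗ[R] K :=
    { toFun := m
      map_add' := fun x y => hi (by simp [hm])
      map_smul' := fun a x => hi (by simp [hm, smul_comm r a]) }
  have hs (x : P) (y : K) (h : i y = r • x) : s x = y := hi ((hm x).trans h.symm)
  let F (f : K →ₗ[R] R) : P →ₗ[R] k :=
    LinearMap.mulLeft R (algebraMap R k r)⁻¹ ∘ₗ Algebra.linearMap R k ∘ₗ f ∘ₗ s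
  have hF (f : K →ₗ[R] R) : LinearMap.ker p ≤
      LinearMap.ker ((LinearMap.range (Algebra.linearMap R k)).mkQ ∘ₗ F f) := by
    intro x hx
    obtain ⟨y, rfl⟩ := (hip x).mp hx
    have : s (i y) = r • y := hs _ _ (by simp)
    rw [LinearMap.mem_ker, LinearMap.comp_apply, Submodule.mkQ_apply,
      Submodule.Quotient.mk_eq_zero]
    exact ⟨f y, by simp [F, this, hr']⟩
  let e := p.quotKerEquivOfSurjective hp
  let D (f : K →ₗ[R] R) : N →ₗ[R] (k ⧸ LinearMap.range (Algebra.linearMap R k)) :=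
    (LinearMap.ker p).liftQ _ (hF f) ∘ₗ e.symm.toLinearMap
  have hD (f : K →ₗ[R] R) (x : P) : D f (p x) = Submodule.Quotient.mk (F f x) := by
    have : e.symm (p x) = Submodule.Quotient.mk x := by
      rw [LinearEquiv.symm_apply_eq]
      rfl
    simp [D, this]
  refine ⟨⟨⟨D, fun f g => ?_⟩, fun a f => ?_⟩, fun f x y h => ?_⟩
  · ext n
    obtain ⟨x, rfl⟩ := hp n
    rw [LinearMap.add_apply, hD, hD, hD, ← Submodule.Quotient.mk_add]
    simp [F, mul_add]
  · ext n
    obtain ⟨x, rfl⟩ := hp n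
    rw [LinearMap.smul_apply, hD, hD, RingHom.id_apply, ← Submodule.Quotient.mk_smul]
    simp [F, Algebra.smul_def, mul_left_comm]
  · change D f (p x) = _
    rw [hD]
    simp [F, hs x y h]

/-!
STATEMENT 3: Let R be a Dedekind domain with field of fractions k, let Λ be an R-order,
and let N be a finitely generated Λ-module that is R-torsion.  Then [N^∨] = −σ[N] in
G₀(Λᵒᵖ), where N^∨ = Hom_R(N, k/R) regarded as a Λᵒᵖ-module.

Here `σ : G₀(Λ) → G₀(Λᵒᵖ)` is the homomorphism induced by the exact duality functor
`M ↦ M* = Hom_R(M,R)` on Λ-lattices; it is universally quantified, subject to the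
characterizing property that for every Λ-lattice `M` (a finitely generated Λ-module,
projective over `R`) it sends `[M]` to `[M*]` (with the Λᵒᵖ-structure `(f·λ)(m)=f(λm)`,
itself quantified and pinned down pointwise).  `k/R` is `k ⧸ range (algebraMap R k)`.
-/
theorem stmt3 (R : Type) [CommRing R] [IsDomain R] [IsDedekindDomain R]
    (k : Type) [Field k] [Algebra R k] [IsFractionRing R k]
    (Λ : Type) [Ring Λ] [Algebra R Λ] [Module.Finite R Λ] [Module.Projective R Λ]
    (σ : G0 Λ →+ G0 Λᵐᵒᵖ)
    (hσ : ∀ (M : Type) [AddCommGroup M] [Module Λ M] [Module.Finite Λ M]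
        [Module R M] [IsScalarTower R Λ M] [Module.Projective R M]
        [Module Λᵐᵒᵖ (M →ₗ[R] R)],
      (∀ (l : Λ) (φ : M →ₗ[R] R) (x : M), (MulOpposite.op l • φ) x = φ (l • x)) →
      σ (G0.cls Λ M) = G0.cls Λᵐᵒᵖ (M →ₗ[R] R))
    (N : Type) [AddCommGroup N] [Module Λ N] [Module.Finite Λ N]
    [Module R N] [IsScalarTower R Λ N]
    (htors : ∀ x : N, ∃ r : R, r ≠ 0 ∧ r • x = 0)
    [mDual : Module Λᵐᵒᵖ (N →ₗ[R] (k ⧸ LinearMap.range (Algebra.linearMap R k)))]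
    (hmDual : ∀ (l : Λ) (φ : N →ₗ[R] (k ⧸ LinearMap.range (Algebra.linearMap R k))) (x : N),
      (MulOpposite.op l • φ) x = φ (l • x)) :
    G0.cls Λᵐᵒᵖ (N →ₗ[R] (k ⧸ LinearMap.range (Algebra.linearMap R k))) =
      - σ (G0.cls Λ N) := by
  obtain ⟨r, hr, hrN⟩ := exists_ne_zero_smul_eq_zero (Λ := Λ) htors
  have hr' : algebraMap R k r ≠ 0 := by simpa using hr
  obtain ⟨n, p, hp⟩ := Module.Finite.exists_fin' Λ N
  let K : Submodule Λ (Fin n → Λ) := LinearMap.ker p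
  have : IsNoetherian R K := isNoetherian_of_injective (K.subtype.restrictScalars R)
    K.injective_subtype
  have : Module.Finite Λ K := Module.Finite.of_restrictScalars_finite R Λ K
  have : Module.IsTorsionFree R K :=
    K.injective_subtype.moduleIsTorsionFree _ fun _ _ => rfl
  have : Module.FinitePresentation R K := Module.finitePresentation_of_finite R K
  have : Module.FinitePresentation R (Fin n → Λ) := Module.finitePresentation_of_finite R _
  have : Module.Projective R K := Module.Flat.projective_of_finitePresentation
  have : Module.Projective R (Fin n → Λ) := Module.Flat.projective_of_finitePresentation
  let := homOpModule R Λ K R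
  let := homOpModule R Λ (Fin n → Λ) R
  have hK : ∀ (l : Λ) (φ : K →ₗ[R] R) (x : K),
      (MulOpposite.op l • φ) x = φ (l • x) := fun _ _ _ => rfl
  have hP : ∀ (l : Λ) (φ : (Fin n → Λ) →ₗ[R] R) (x : Fin n → Λ),
      (MulOpposite.op l • φ) x = φ (l • x) := fun _ _ _ => rfl
  have : Module.Finite Λᵐᵒᵖ (K →ₗ[R] R) := .op_of_hom hK
  have : Module.Finite Λᵐᵒᵖ ((Fin n → Λ) →ₗ[R] R) := .op_of_hom hP
  have hexact : Function.Exact K.subtype p := LinearMap.exact_subtype_ker_map p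
  have hmem (x : Fin n → Λ) : r • x ∈ K := by
    rw [LinearMap.mem_ker, LinearMap.map_smul_of_tower, hrN]
  obtain ⟨δ, hδ⟩ := exists_connecting (k := k) (K.subtype.restrictScalars R)
    K.injective_subtype (p.restrictScalars R) hp hexact hr hrN
  replace hδ (f : K →ₗ[R] R) (x : Fin n → Λ) : δ f (p x) =
      Submodule.Quotient.mk ((algebraMap R k r)⁻¹ * algebraMap R k (f ⟨r • x, hmem x⟩)) :=
    hδ f x ⟨r • x, hmem x⟩ rfl
  let δ' : (K →ₗ[R] R) →ₗ[Λᵐᵒᵖ]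
      (N →ₗ[R] (k ⧸ LinearMap.range (Algebra.linearMap R k))) :=
    { toFun := δ
      map_add' := map_add δ
      map_smul' := fun l f => by
        induction l using MulOpposite.rec' with | _ l =>
        ext x
        obtain ⟨x, rfl⟩ := hp x
        rw [RingHom.id_apply, hmDual, ← map_smul, hδ, hδ, hK]
        congr 4
        exact Subtype.ext (smul_comm l r x) }
  let ι : ((Fin n → Λ) →ₗ[R] R) →ₗ[Λᵐᵒᵖ] (K →ₗ[R] R) :=
    { toFun := fun φ => φ ∘ₗ K.subtype.restrictScalars R
      map_add' := fun _ _ => rfl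
      map_smul' := fun _ _ => rfl }
  have hι (φ : (Fin n → Λ) →ₗ[R] R) (y : K) : ι φ y = φ y := rfl
  have hι_inj : Function.Injective ι := by
    intro φ ψ h
    refine LinearMap.ext fun x => ?_
    have := DFunLike.congr_fun h ⟨r • x, hmem x⟩
    rw [hι, hι] at this
    simpa [hr] using this
  have hδ_surj : Function.Surjective δ' := by
    intro ψ
    obtain ⟨F, hF⟩ := Module.projective_lifting_property
      (LinearMap.range (Algebra.linearMap R k)).mkQ (ψ ∘ₗ p.restrictScalars R)
      (Submodule.mkQ_surjective _)
    replace hF (x : Fin n → Λ) : Submodule.Quotient.mk (F x) = ψ (p x) :=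
      DFunLike.congr_fun hF x
    have hFK (y : K) : F y ∈ LinearMap.range (Algebra.linearMap R k) := by
      rw [← Submodule.Quotient.mk_eq_zero, hF, LinearMap.mem_ker.mp y.2, map_zero]
    let e := LinearEquiv.ofInjective (Algebra.linearMap R k) (IsFractionRing.injective R k)
    let f : K →ₗ[R] R := e.symm.toLinearMap ∘ₗ
      (F ∘ₗ K.subtype.restrictScalars R).codRestrict _ hFK
    have hf (y : K) : algebraMap R k (f y) = F y :=
      congrArg Subtype.val (e.apply_symm_apply ⟨F y, hFK y⟩)
    refine ⟨f, LinearMap.ext fun x => ?_⟩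
    obtain ⟨x, rfl⟩ := hp x
    refine (hδ f x).trans ?_
    rw [hf, ← hF, map_smul, Algebra.smul_def, inv_mul_cancel_left₀ hr']
  have hιδ : Function.Exact ι δ' := by
    intro f
    constructor
    · intro h
      have hdvd (x : Fin n → Λ) : ∃ a : R, r * a = f ⟨r • x, hmem x⟩ := by
        have := (hδ f x).symm.trans (DFunLike.congr_fun h (p x))
        rw [LinearMap.zero_apply, Submodule.Quotient.mk_eq_zero] at this
        obtain ⟨a, ha⟩ := this
        refine ⟨a, IsFractionRing.injective R k ?_⟩
        rw [map_mul, ← Algebra.linearMap_apply R k a, ha, mul_inv_cancel_left₀ hr']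
      choose a ha using hdvd
      refine ⟨⟨⟨a, fun x y => mul_left_cancel₀ hr ?_⟩, fun c x => mul_left_cancel₀ hr ?_⟩,
        LinearMap.ext fun y => mul_left_cancel₀ hr ?_⟩
      · rw [mul_add, ha, ha, ha, ← map_add]
        exact congrArg f (Subtype.ext (smul_add r x y))
      · rw [RingHom.id_apply, smul_eq_mul, mul_left_comm, ha, ha, ← smul_eq_mul, ← map_smul]
        exact congrArg f (Subtype.ext (smul_comm r c x))
      · refine (ha y).trans ?_
        rw [← smul_eq_mul, ← map_smul]
        rfl
    · rintro ⟨φ, rfl⟩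
      refine LinearMap.ext fun x => ?_
      obtain ⟨x, rfl⟩ := hp x
      refine (hδ _ x).trans ?_
      rw [LinearMap.zero_apply, Submodule.Quotient.mk_eq_zero]
      refine ⟨φ x, ?_⟩
      rw [hι, map_smul, smul_eq_mul, map_mul, inv_mul_cancel_left₀ hr', Algebra.linearMap_apply]
  have : Module.Finite Λᵐᵒᵖ (N →ₗ[R] (k ⧸ LinearMap.range (Algebra.linearMap R k))) :=
    Module.Finite.of_surjective δ' hδ_surj
  have h₁ := congrArg σ (G0.cls_eq_add_of_exact K.subtype p K.injective_subtype hp hexact)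
  have h₂ := G0.cls_eq_add_of_exact ι δ' hι_inj hδ_surj hιδ
  rw [map_add, hσ K hK, hσ (Fin n → Λ) hP, h₂] at h₁
  rw [eq_neg_iff_add_eq_zero]
  rwa [add_assoc, left_eq_add] at h₁
end

section
/- Let F/K be a finite Galois extension of number fields with Galois group G, let S∞ be the set of archimedean places of F, and let d be the degree of K over ℚ. Then the equality [Hom_cts(comp(F_ℝ^×), ℝ/ℤ)] = d·[ℤ[G]] − [ℤ[S∞]] holds in G₀(ℤ[G]). -/
open NumberField
open scoped nonZeroDivisors TensorProduct

noncomputable section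

variable (F : Type) [Field F] [NumberField F]

/-- The étale ℝ-algebra F_ℝ = F ⊗_ℚ ℝ. -/
abbrev FReal := ℝ ⊗[ℚ] F

/-- The canonical (finite-dimensional real vector space) topology on F_ℝ. -/
instance : TopologicalSpace (FReal F) :=
  TopologicalSpace.induced (Module.finBasis ℝ (FReal F)).equivFun inferInstance

/-- The group of fractional ideals of F. -/
abbrev IdealGroup := (FractionalIdeal (𝓞 F)⁰ F)ˣ

/-- The group of fractional ideals carries the discrete topology. -/
instance : TopologicalSpace (IdealGroup F) := ⊥

/-- The ideal norm, as a group homomorphism to ℝˣ. -/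
def idealNormHom : IdealGroup F →* ℝˣ :=
  (Units.map (Rat.castHom ℝ).toMonoidHom).comp
    (Units.map (FractionalIdeal.absNorm (R := 𝓞 F) (K := F)).toMonoidHom)

/-- The absolute value of the algebra norm on F_ℝˣ, as a group homomorphism to ℝˣ. -/
def absNormFR : (FReal F)ˣ →* ℝˣ :=
  (Units.map (absHom (α := ℝ)).toMonoidHom).comp (Units.map (Algebra.norm ℝ (S := FReal F)))

/-- The fibre product Id_F ×_{ℝ>0} F_ℝˣ, i.e. the subgroup of pairs (I, b) with
N(I) = |Nm(b)|, formalized as the kernel of the quotient of the two norm maps. -/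
def picDom : Subgroup (IdealGroup F × (FReal F)ˣ) :=
  MonoidHom.ker (((idealNormHom F).comp (MonoidHom.fst _ _)) /
    ((absNormFR F).comp (MonoidHom.snd _ _)))

/-- The map F^× → Id_F ×_{ℝ>0} F_ℝˣ, α ↦ (αO_F, α ⊗ 1). -/
def principalHom : Fˣ →* IdealGroup F × (FReal F)ˣ :=
  (toPrincipalIdeal (𝓞 F) F).prod
    (Units.map (Algebra.TensorProduct.includeRight : F →ₐ[ℚ] FReal F).toMonoidHom)

/-- The subgroup of the fibre product coming from principal oriented Arakelov divisors. -/
def principalSub : Subgroup (picDom F) :=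
  Subgroup.comap (picDom F).subtype (MonoidHom.range (principalHom F))

/-- The oriented Arakelov class group of F: the cokernel of F^× → Id_F ×_{ℝ>0} F_ℝˣ. -/
def PicTilde := picDom F ⧸ principalSub F

instance : CommGroup (PicTilde F) := QuotientGroup.Quotient.commGroup _
instance : TopologicalSpace (PicTilde F) := instTopologicalSpaceQuotient

/-- The class of an oriented Arakelov divisor in the oriented Arakelov class group. -/
def PicTilde.mk : picDom F → PicTilde F := QuotientGroup.mk

/-- The maximal compact subgroup comp(F_ℝˣ) of F_ℝˣ: the subgroup generated by all
compact subgroups. -/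
def maxCompact : Subgroup (FReal F)ˣ :=
  sSup { H : Subgroup (FReal F)ˣ | IsCompact (H : Set (FReal F)ˣ) }

/-- The image of {1} × comp(F_ℝˣ) in the oriented Arakelov class group. -/
def compImage : Subgroup (PicTilde F) :=
  Subgroup.map (QuotientGroup.mk' (principalSub F))
    (Subgroup.comap (picDom F).subtype ((⊥ : Subgroup (IdealGroup F)).prod (maxCompact F)))

/-- The Arakelov class group of F: the quotient of the oriented Arakelov class group by
the image of {1} × comp(F_ℝˣ). -/
def PicZero := PicTilde F ⧸ compImage F

instance : CommGroup (PicZero F) := QuotientGroup.Quotient.commGroup _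
instance : TopologicalSpace (PicZero F) := instTopologicalSpaceQuotient

/-- The class of an oriented Arakelov divisor in the Arakelov class group. -/
def PicZero.mk : picDom F → PicZero F := fun x => QuotientGroup.mk (PicTilde.mk F x)

/-- ℝ/ℤ. -/
abbrev RmodZ := AddCircle (1 : ℝ)

/-- The Pontryagin dual Ãr_F of the oriented Arakelov class group: the group of
continuous homomorphisms to ℝ/ℤ. -/
def ArTilde := ContinuousAddMonoidHom (Additive (PicTilde F)) RmodZ

instance : AddCommGroup (ArTilde F) := by unfold ArTilde; infer_instance
instance : FunLike (ArTilde F) (Additive (PicTilde F)) RmodZ := by unfold ArTilde; infer_instance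

/-- The Pontryagin dual Ar_F of the Arakelov class group. -/
def ArF := ContinuousAddMonoidHom (Additive (PicZero F)) RmodZ

instance : AddCommGroup (ArF F) := by unfold ArF; infer_instance
instance : FunLike (ArF F) (Additive (PicZero F)) RmodZ := by unfold ArF; infer_instance

/-- ℚ/ℤ as a ℤ-module. -/
abbrev QmodZ := ℚ ⧸ (Submodule.span ℤ {(1 : ℚ)})

variable {F} in
/-- The automorphism of F_ℝ = ℝ ⊗_ℚ F induced by an automorphism of F over a subfield K. -/
def galFReal (K : Type) [Field K] [CharZero K] [Algebra K F] (g : F ≃ₐ[K] F) : FReal F ≃ₐ[ℚ] FReal F :=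
  Algebra.TensorProduct.congr AlgEquiv.refl (g.restrictScalars ℚ)

end

open AddCircle MeasureTheory in
/-- On a compact abelian group, a group of characters that separates points contains every
character. -/
theorem mem_of_separatesPoints {A : Type} [AddCommGroup A] [TopologicalSpace A]
    [IsTopologicalAddGroup A] [CompactSpace A] (Λ : AddSubgroup (A →ₜ+ AddCircle (1 : ℝ)))
    (hΛ : ∀ x y : A, x ≠ y → ∃ ψ ∈ Λ, ψ x ≠ ψ y) (φ : A →ₜ+ AddCircle (1 : ℝ)) : φ ∈ Λ := by
  classical
  by_contra hφ
  let ch : (A →ₜ+ AddCircle (1 : ℝ)) → C(A, ℂ) := fun ψ =>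
    ⟨fun a => (toCircle (ψ a) : ℂ),
      continuous_subtype_val.comp (continuous_toCircle.comp (map_continuous ψ))⟩
  have ch_apply : ∀ ψ a, ch ψ a = (toCircle (ψ a) : ℂ) := fun _ _ => rfl
  have ch_add : ∀ ψ₁ ψ₂, ch (ψ₁ + ψ₂) = ch ψ₁ * ch ψ₂ := by
    intro ψ₁ ψ₂
    ext a
    simp [ch_apply, toCircle_add]
  have ch_neg : ∀ ψ, ch (-ψ) = star (ch ψ) := by
    intro ψ
    ext a
    change (toCircle (-ψ a) : ℂ) = _
    rw [toCircle_neg, Circle.coe_inv_eq_conj]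
    rfl
  have ch_zero : ch 0 = 1 := by
    ext a
    simp [ch_apply]
  let X : Set C(A, ℂ) := ch '' Λ
  let S : StarSubalgebra ℂ C(A, ℂ) :=
    { toSubalgebra := Algebra.adjoin ℂ X
      star_mem' := by
        change Algebra.adjoin ℂ X ≤ star (Algebra.adjoin ℂ X)
        refine Algebra.adjoin_le ?_
        rintro - ⟨ψ, hψ, rfl⟩
        refine Algebra.subset_adjoin ⟨-ψ, Λ.neg_mem hψ, ch_neg ψ⟩ }
  have hspan : Subalgebra.toSubmodule S.toSubalgebra = Submodule.span ℂ X := by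
    apply Algebra.adjoin_eq_span_of_subset
    refine Set.Subset.trans ?_ Submodule.subset_span
    intro x hx
    refine Submonoid.closure_induction (fun _ h => h) ⟨0, Λ.zero_mem, ch_zero⟩ ?_ hx
    rintro _ _ _ _ ⟨ψ₁, h₁, rfl⟩ ⟨ψ₂, h₂, rfl⟩
    exact ⟨_, Λ.add_mem h₁ h₂, ch_add _ _⟩
  have hsep : S.SeparatesPoints := by
    intro x y hxy
    obtain ⟨ψ, hψ, hne⟩ := hΛ x y hxy
    refine ⟨_, ⟨ch ψ, Algebra.subset_adjoin ⟨ψ, hψ, rfl⟩, rfl⟩, ?_⟩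
    intro h
    exact hne (injective_toCircle one_ne_zero (Circle.ext h))
  have htop := ContinuousMap.starSubalgebra_topologicalClosure_eq_top_of_separatesPoints S hsep
  let : MeasurableSpace A := borel A
  have : BorelSpace A := ⟨rfl⟩
  let μ : Measure A := Measure.addHaarMeasure ⊤
  have : IsProbabilityMeasure μ := ⟨Measure.addHaarMeasure_self⟩
  have orth : ∀ ψ : A →ₜ+ AddCircle (1 : ℝ), ψ ≠ 0 → ∫ x, ch ψ x ∂μ = 0 := by
    intro ψ hψ
    obtain ⟨a, ha⟩ : ∃ a, ψ a ≠ 0 := by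
      by_contra! h
      exact hψ (ContinuousAddMonoidHom.ext h)
    have h1 : ∫ x, ch ψ (a + x) ∂μ = ∫ x, ch ψ x ∂μ := integral_add_left_eq_self _ a
    have h2 : ∀ x, ch ψ (a + x) = ch ψ a * ch ψ x := by
      intro x
      simp [ch_apply, toCircle_add]
    simp_rw [h2, integral_const_mul] at h1
    have h3 : ch ψ a ≠ 1 := by
      intro h
      refine ha (injective_toCircle one_ne_zero (Circle.ext ?_))
      simpa [ch_apply] using h
    by_contra h0
    exact h3 (mul_right_cancel₀ h0 (by rw [h1, one_mul]))
  have hint : ∀ f : C(A, ℂ), Integrable (fun x => f x) μ := fun f =>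
    f.continuous.integrable_of_hasCompactSupport (HasCompactSupport.of_compactSpace _)
  have horth : ∀ f ∈ Submodule.span ℂ X, ∫ x, (f * ch (-φ)) x ∂μ = 0 := by
    intro f hf
    induction hf using Submodule.span_induction with
    | mem f h =>
      obtain ⟨ψ, hψ, rfl⟩ := h
      rw [← ch_add]
      refine orth _ fun h => hφ ?_
      rwa [← eq_of_sub_eq_zero ((sub_eq_add_neg ψ φ).trans h)]
    | zero => simp
    | add f g _ _ hf hg =>
      rw [add_mul]
      simp only [ContinuousMap.add_apply]
      rw [integral_add (hint _) (hint _), hf, hg, add_zero]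
    | smul c f _ hf =>
      rw [smul_mul_assoc]
      simp only [ContinuousMap.smul_apply]
      rw [integral_smul, hf, smul_zero]
  have hmem : ch φ ∈ closure (S : Set C(A, ℂ)) := by
    rw [← StarSubalgebra.topologicalClosure_coe, htop]
    trivial
  obtain ⟨f, hfS, hf⟩ := Metric.mem_closure_iff.1 hmem (1 / 2) (by norm_num)
  have h1 : ∫ x, ((ch φ - f) * ch (-φ)) x ∂μ = 1 := by
    have : ∀ x, ((ch φ - f) * ch (-φ)) x = (1 : ℂ) - (f * ch (-φ)) x := by
      intro x
      rw [sub_mul, ← ch_add, add_neg_cancel, ch_zero]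
      rfl
    simp_rw [this]
    rw [integral_sub (integrable_const _) (hint _), horth f (hspan ▸ hfS)]
    simp
  have h2 : ‖∫ x, ((ch φ - f) * ch (-φ)) x ∂μ‖ ≤ 1 / 2 * μ.real Set.univ := by
    refine norm_integral_le_of_norm_le_const (Filter.Eventually.of_forall fun x => ?_)
    rw [ContinuousMap.mul_apply, norm_mul, ch_apply, Circle.norm_coe, mul_one]
    refine ((ch φ - f).norm_coe_le_norm x).trans ?_
    rw [← dist_eq_norm]
    exact hf.le
  rw [h1] at h2
  norm_num at h2

section realEmbedding

variable {F : Type} [Field F] [NumberField F]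

/-- The ℝ-linear extension to `F_ℝ` of a complex embedding of `F`. -/
noncomputable def evalC (σ : F →+* ℂ) : FReal F →ₐ[ℝ] ℂ :=
  Algebra.TensorProduct.lift (Algebra.ofId ℝ ℂ) σ.toRatAlgHom (fun _ _ => Commute.all _ _)

theorem evalC_tmul (σ : F →+* ℂ) (r : ℝ) (a : F) : evalC σ (r ⊗ₜ a) = r * σ a := by
  simp [evalC, Algebra.ofId_apply]

theorem evalC_galFReal {K : Type} [Field K] [CharZero K] [Algebra K F] (σ : F →+* ℂ)
    (g : F ≃ₐ[K] F) (x : FReal F) :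
    evalC σ (galFReal K g x) = evalC (σ.comp (g : F →+* F)) x := by
  induction x using TensorProduct.induction_on with
  | zero => simp
  | add x y hx hy => simp [hx, hy]
  | tmul r a =>
    have : galFReal K g (r ⊗ₜ a) = r ⊗ₜ g a := by simp [galFReal]
    rw [this, evalC_tmul, evalC_tmul]
    rfl

theorem evalC_conjugate (σ : F →+* ℂ) (x : FReal F) :
    evalC (ComplexEmbedding.conjugate σ) x = starRingEnd ℂ (evalC σ x) := by
  induction x using TensorProduct.induction_on with
  | zero => simp
  | add x y hx hy => simp [hx, hy]
  | tmul r a => simp [evalC_tmul]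

variable (F) in
/-- The ℝ-linear map from `F_ℝ` to `ℂ^Hom(F, ℂ)` given by all complex embeddings. -/
noncomputable def evalPi : FReal F →ₗ[ℝ] ((F →+* ℂ) → ℂ) :=
  LinearMap.pi fun σ => (evalC σ).toLinearMap

theorem evalPi_apply (x : FReal F) (σ : F →+* ℂ) : evalPi F x σ = evalC σ x := rfl

variable (F) in
/-- The real basis of `F_ℝ` given by an integral basis of `F`. -/
noncomputable def realBasis :
    Module.Basis (Module.Free.ChooseBasisIndex ℤ (𝓞 F)) ℝ (FReal F) :=
  Algebra.TensorProduct.basis ℝ (integralBasis F)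

theorem evalPi_realBasis (i) :
    evalPi F (realBasis F i) = canonicalEmbedding.latticeBasis F i := by
  ext σ
  rw [canonicalEmbedding.latticeBasis_apply, evalPi_apply, realBasis,
    Algebra.TensorProduct.basis_apply, evalC_tmul]
  simp [canonicalEmbedding.apply_at]

theorem latticeBasis_repr_evalPi (x : FReal F) (i) :
    (canonicalEmbedding.latticeBasis F).repr (evalPi F x) i = ((realBasis F).repr x i : ℂ) := by
  have h : evalPi F x =
      ∑ j, ((realBasis F).repr x j : ℂ) • canonicalEmbedding.latticeBasis F j := by
    conv_lhs => rw [← (realBasis F).sum_repr x, map_sum]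
    refine Finset.sum_congr rfl fun j _ => ?_
    rw [map_smul, evalPi_realBasis]
    rfl
  rw [h, Module.Basis.repr_sum_self]

theorem evalPi_injective : Function.Injective (evalPi F) := by
  intro x y h
  refine (realBasis F).ext_elem fun i => ?_
  have := latticeBasis_repr_evalPi x i
  rw [h, latticeBasis_repr_evalPi] at this
  exact_mod_cast this.symm

theorem exists_evalPi_eq (z : (F →+* ℂ) → ℂ)
    (hz : ∀ σ, z (ComplexEmbedding.conjugate σ) = starRingEnd ℂ (z σ)) :
    ∃ x, evalPi F x = z := by
  let L := canonicalEmbedding.latticeBasis F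
  have h : z = ∑ i, starRingEnd ℂ (L.repr z i) • L i := by
    ext σ
    have h1 := congrFun (L.sum_repr z) (ComplexEmbedding.conjugate σ)
    rw [hz, ← (starRingEnd ℂ).injective.eq_iff, Complex.conj_conj] at h1
    rw [← h1]
    simp [L, canonicalEmbedding.apply_at]
  have hreal : ∀ i, starRingEnd ℂ (L.repr z i) = L.repr z i := by
    intro i
    conv_rhs => rw [h, Module.Basis.repr_sum_self]
  refine ⟨∑ i, (L.repr z i).re • realBasis F i, L.ext_elem fun i => ?_⟩
  rw [latticeBasis_repr_evalPi, Module.Basis.repr_sum_self]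
  exact Complex.conj_eq_iff_re.1 (hreal i)

theorem isClosedEmbedding_evalPi : Topology.IsClosedEmbedding (evalPi F) := by
  let e := (Module.finBasis ℝ (FReal F)).equivFun
  let e' : FReal F ≃ₜ (Fin (Module.finrank ℝ (FReal F)) → ℝ) :=
    e.toEquiv.toHomeomorphOfIsInducing ⟨rfl⟩
  have h : Topology.IsClosedEmbedding (evalPi F ∘ₗ e.symm.toLinearMap) :=
    LinearMap.isClosedEmbedding_of_injective
      (LinearMap.ker_eq_bot.2 (evalPi_injective.comp e.symm.injective))
  have h2 := h.comp e'.isClosedEmbedding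
  convert h2 using 1
  ext x : 1
  simp [e', e]

theorem continuous_evalC (σ : F →+* ℂ) : Continuous (evalC σ) :=
  (continuous_apply σ).comp isClosedEmbedding_evalPi.continuous

instance : T2Space (FReal F) := isClosedEmbedding_evalPi.isEmbedding.t2Space

instance : ContinuousMul (FReal F) where
  continuous_mul := by
    rw [isClosedEmbedding_evalPi.isInducing.continuous_iff]
    refine continuous_pi fun σ => ?_
    simp only [Function.comp_apply, evalPi_apply, map_mul]
    exact ((continuous_evalC σ).comp continuous_fst).mul ((continuous_evalC σ).comp continuous_snd)

variable (F) in
/-- The subgroup of units of `F_ℝ` all of whose conjugates have absolute value one. -/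
noncomputable def normOneUnits : Subgroup (FReal F)ˣ where
  carrier := {x | ∀ σ : F →+* ℂ, ‖evalC σ (x : FReal F)‖ = 1}
  one_mem' := by simp
  mul_mem' := by
    intro x y hx hy σ
    simp [hx σ, hy σ]
  inv_mem' := by
    intro x hx σ
    have h : ‖evalC σ ((x : FReal F) * (x⁻¹ : (FReal F)ˣ))‖ = 1 := by simp
    rwa [map_mul, norm_mul, hx σ, one_mul] at h

theorem isCompact_normOneUnits : IsCompact (normOneUnits F : Set (FReal F)ˣ) := by
  let S : Set (FReal F) := evalPi F ⁻¹' Set.univ.pi fun _ => Metric.sphere 0 1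
  have hS : IsCompact S := isClosedEmbedding_evalPi.isCompact_preimage
    (isCompact_univ_pi fun _ => isCompact_sphere _ _)
  have hS' : IsCompact (S ×ˢ (MulOpposite.op '' S)) :=
    hS.prod (hS.image MulOpposite.continuous_op)
  convert Units.isClosedEmbedding_embedProduct.isCompact_preimage hS' using 1
  ext x
  have hmem : ∀ y : FReal F, y ∈ S ↔ ∀ σ : F →+* ℂ, ‖evalC σ y‖ = 1 := by
    intro y
    simp [S, evalPi_apply]
  constructor
  · intro hx
    exact ⟨(hmem _).2 hx, _, (hmem _).2 ((normOneUnits F).inv_mem hx), rfl⟩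
  · rintro ⟨hx, -⟩
    exact (hmem _).1 hx

theorem le_normOneUnits {H : Subgroup (FReal F)ˣ} (hH : IsCompact (H : Set (FReal F)ˣ)) :
    H ≤ normOneUnits F := by
  intro x hx σ
  have hle : ∀ y ∈ H, ‖evalC σ (y : FReal F)‖ ≤ 1 := by
    intro y hy
    obtain ⟨B, hB⟩ := (hH.image (((continuous_evalC σ).comp Units.continuous_val).norm)).bddAbove
    by_contra! h
    obtain ⟨n, hn⟩ := pow_unbounded_of_one_lt B h
    have := hB ⟨y ^ n, H.pow_mem hy n, rfl⟩
    simp only [Function.comp_apply, Units.val_pow_eq_pow_val, map_pow, norm_pow] at this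
    exact this.not_gt hn
  refine le_antisymm (hle x hx) ?_
  have h : ‖evalC σ ((x : FReal F) * (x⁻¹ : (FReal F)ˣ))‖ = 1 := by simp
  rw [map_mul, norm_mul] at h
  nlinarith [hle _ (H.inv_mem hx), norm_nonneg (evalC σ (x : FReal F))]

theorem maxCompact_eq : maxCompact F = normOneUnits F :=
  le_antisymm (sSup_le fun _ hH => le_normOneUnits hH) (le_sSup isCompact_normOneUnits)

theorem norm_evalC (x : maxCompact F) (σ : F →+* ℂ) :
    ‖evalC σ ((x : (FReal F)ˣ) : FReal F)‖ = 1 :=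
  (maxCompact_eq (F := F) ▸ x.2 : (x : (FReal F)ˣ) ∈ normOneUnits F) σ

instance : CompactSpace (maxCompact F) := by
  refine isCompact_iff_compactSpace.1 (?_ : IsCompact (maxCompact F : Set (FReal F)ˣ))
  rw [maxCompact_eq]
  exact isCompact_normOneUnits

theorem exists_maxCompact_evalC_eq (z : (F →+* ℂ) → ℂ) (hz : ∀ σ, ‖z σ‖ = 1)
    (hz' : ∀ σ, z (ComplexEmbedding.conjugate σ) = starRingEnd ℂ (z σ)) :
    ∃ x : maxCompact F, ∀ σ, evalC σ ((x : (FReal F)ˣ) : FReal F) = z σ := by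
  obtain ⟨x, hx⟩ := exists_evalPi_eq z hz'
  obtain ⟨y, hy⟩ := exists_evalPi_eq (fun σ => starRingEnd ℂ (z σ)) (fun σ => by simp [hz'])
  have hxy : x * y = 1 := by
    refine evalPi_injective (funext fun σ => ?_)
    have hx := congrFun hx σ
    have hy := congrFun hy σ
    simp only [evalPi_apply] at hx hy ⊢
    rw [map_mul, hx, hy, map_one, Complex.mul_conj, Complex.normSq_eq_norm_sq, hz]
    simp
  refine ⟨⟨⟨x, y, hxy, by rw [mul_comm, hxy]⟩, ?_⟩, fun σ => congrFun hx σ⟩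
  rw [maxCompact_eq]
  intro σ
  rw [← hz σ, ← hx]
  rfl

end realEmbedding

section grothendieck

variable {R : Type} [Ring R]

/-- The quotient map from the free abelian group on finitely generated modules to `G₀(R)`. -/
def G0.mk (R : Type) [Ring R] : FreeAbelianGroup (FGMod R) →+ G0 R :=
  QuotientAddGroup.mk' (G0Rel R)

theorem G0.cls_eq (M : Type) [AddCommGroup M] [Module R M] [h : Module.Finite R M] :
    G0.cls R M = G0.mk R (FreeAbelianGroup.of (FGMod.mk (R := R) M)) :=
  dif_pos h

theorem G0.cls_of_exact {L M N : Type} [AddCommGroup L] [Module R L] [Module.Finite R L]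
    [AddCommGroup M] [Module R M] [Module.Finite R M]
    [AddCommGroup N] [Module R N] [Module.Finite R N]
    (f : L →ₗ[R] M) (g : M →ₗ[R] N) (hf : Function.Injective f) (hg : Function.Surjective g)
    (h : Function.Exact f g) : G0.cls R M = G0.cls R L + G0.cls R N := by
  rw [G0.cls_eq, G0.cls_eq, G0.cls_eq, ← sub_eq_zero, ← sub_sub, ← map_sub, ← map_sub]
  exact (QuotientAddGroup.eq_zero_iff _).2
    (AddSubgroup.subset_closure ⟨FGMod.mk L, FGMod.mk M, FGMod.mk N, f, g, hf, hg, h, rfl⟩)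

theorem G0.cls_eq_zero (M : Type) [AddCommGroup M] [Module R M] [Subsingleton M] :
    G0.cls R M = 0 := by
  have h := G0.cls_of_exact (R := R) (L := M) (M := M) (N := M) 0 0
    (Function.injective_of_subsingleton _) (fun y => ⟨0, Subsingleton.elim _ _⟩)
    (fun y => ⟨fun _ => ⟨0, Subsingleton.elim _ _⟩, fun _ => Subsingleton.elim _ _⟩)
  exact left_eq_add.1 h

theorem G0.cls_fin_fun (n : ℕ) : G0.cls R (Fin n → R) = n • G0.cls R R := by
  induction n with
  | zero => rw [zero_smul, G0.cls_eq_zero]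
  | succ n ih =>
    let f : (Fin n → R) →ₗ[R] (Fin (n + 1) → R) :=
      { toFun := fun x => Fin.cons 0 x
        map_add' := fun x y => by
          funext i
          refine Fin.cases ?_ (fun _ => ?_) i <;> simp
        map_smul' := fun c x => by
          funext i
          refine Fin.cases ?_ (fun _ => ?_) i <;> simp }
    rw [G0.cls_of_exact f (LinearMap.proj 0) (Fin.cons_right_injective (α := fun _ => R) 0)
      (fun y => ⟨fun _ => y, rfl⟩), ih, succ_nsmul]
    intro x
    constructor
    · intro h
      exact ⟨Fin.tail x, (congrArg (Fin.cons · (Fin.tail x)) (Eq.symm h)).trans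
        (Fin.cons_self_tail x)⟩
    · rintro ⟨y, rfl⟩
      rfl

end grothendieck

section placeWeight

variable {F : Type} [Field F]

/-- The number of summands of `σ + conj σ` that are equal to `σ`, as a function of the place. -/
noncomputable def placeWeight (w : InfinitePlace F) : ℤ :=
  open Classical in if w.IsReal then 2 else 1

theorem placeWeight_ne_zero (w : InfinitePlace F) : placeWeight w ≠ 0 := by
  unfold placeWeight
  split_ifs <;> norm_num

theorem placeWeight_smul {K : Type} [Field K] [Algebra K F] (σ : F ≃ₐ[K] F) (w : InfinitePlace F) :
    placeWeight (σ • w) = placeWeight w :=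
  open Classical in if_congr InfinitePlace.isReal_smul_iff rfl rfl

end placeWeight

section characters

variable {F : Type} [Field F] [NumberField F]

/-- The homomorphism from `comp(F_ℝˣ)` to the unit circle given by a complex embedding. -/
noncomputable def evalCircle (σ : F →+* ℂ) : maxCompact F →* Circle where
  toFun x := ⟨evalC σ ((x : (FReal F)ˣ) : FReal F),
    mem_sphere_zero_iff_norm.2 (norm_evalC x σ)⟩
  map_one' := Circle.ext (map_one (evalC σ))
  map_mul' _ _ := Circle.ext (map_mul (evalC σ) _ _)

theorem continuous_evalCircle (σ : F →+* ℂ) : Continuous (evalCircle σ) :=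
  Continuous.subtype_mk ((continuous_evalC σ).comp
    (Units.continuous_val.comp continuous_subtype_val)) _

/-- The character of `comp(F_ℝˣ)` given by a complex embedding of `F`. -/
noncomputable def embChar (σ : F →+* ℂ) :
    ContinuousAddMonoidHom (Additive (maxCompact F)) RmodZ where
  toFun x := (AddCircle.homeomorphCircle one_ne_zero).symm (evalCircle σ x.toMul)
  map_zero' := by
    rw [Homeomorph.symm_apply_eq, AddCircle.homeomorphCircle_apply, AddCircle.toCircle_zero,
      toMul_zero, map_one]
  map_add' x y := by
    rw [Homeomorph.symm_apply_eq, AddCircle.homeomorphCircle_apply, AddCircle.toCircle_add,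
      ← AddCircle.homeomorphCircle_apply one_ne_zero,
      ← AddCircle.homeomorphCircle_apply one_ne_zero, Homeomorph.apply_symm_apply,
      Homeomorph.apply_symm_apply, toMul_add, map_mul]
  continuous_toFun := (Homeomorph.continuous_symm _).comp <|
    (continuous_evalCircle σ).comp continuous_toMul

theorem toCircle_embChar (σ : F →+* ℂ) (x : maxCompact F) :
    ((AddCircle.toCircle (embChar σ (Additive.ofMul x)) : Circle) : ℂ) =
      evalC σ ((x : (FReal F)ˣ) : FReal F) := by
  rw [← AddCircle.homeomorphCircle_apply one_ne_zero]
  exact congrArg ((↑) : Circle → ℂ)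
    ((AddCircle.homeomorphCircle one_ne_zero).apply_symm_apply (evalCircle σ x))

theorem toCircle_injective_coe {a b : RmodZ}
    (h : ((AddCircle.toCircle a : Circle) : ℂ) = (AddCircle.toCircle b : Circle)) : a = b :=
  AddCircle.injective_toCircle one_ne_zero (Circle.ext h)

theorem mem_of_embChar_mem (Λ : AddSubgroup (ContinuousAddMonoidHom (Additive (maxCompact F)) RmodZ))
    (hΛ : ∀ σ, embChar σ ∈ Λ) (φ : ContinuousAddMonoidHom (Additive (maxCompact F)) RmodZ) :
    φ ∈ Λ := by
  have : CompactSpace (Additive (maxCompact F)) := inferInstanceAs (CompactSpace (maxCompact F))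
  refine mem_of_separatesPoints Λ (fun x y hxy => ?_) φ
  by_contra! h
  refine hxy (Additive.toMul.injective (Subtype.ext (Units.ext (evalPi_injective ?_))))
  funext σ
  have := h _ (hΛ σ)
  rw [evalPi_apply, evalPi_apply, ← toCircle_embChar, ← toCircle_embChar]
  exact congrArg (fun t : RmodZ => ((AddCircle.toCircle t : Circle) : ℂ)) this

theorem toCircle_sum_zsmul_embChar (n : (F →+* ℂ) → ℤ) (x : maxCompact F) :
    ((AddCircle.toCircle ((∑ σ, n σ • embChar σ) (Additive.ofMul x)) : Circle) : ℂ) =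
      ∏ σ, evalC σ ((x : (FReal F)ˣ) : FReal F) ^ n σ := by
  let ev : ContinuousAddMonoidHom (Additive (maxCompact F)) RmodZ →+ RmodZ :=
    { toFun := fun φ => φ (Additive.ofMul x)
      map_zero' := rfl
      map_add' := fun _ _ => rfl }
  let c : Multiplicative RmodZ →* ℂ :=
    { toFun := fun t => (AddCircle.toCircle t.toAdd : Circle)
      map_one' := by simp
      map_mul' := fun a b => by simp [AddCircle.toCircle_add] }
  have h1 : (∑ σ, n σ • embChar σ) (Additive.ofMul x) =
      ∑ σ, n σ • embChar σ (Additive.ofMul x) := by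
    change ev _ = _
    rw [map_sum]
    exact Finset.sum_congr rfl fun σ _ => map_zsmul ev _ _
  rw [h1]
  change c (Multiplicative.ofAdd (∑ σ, n σ • embChar σ (Additive.ofMul x))) = _
  rw [ofAdd_sum, map_prod]
  refine Finset.prod_congr rfl fun σ _ => ?_
  change ((AddCircle.toCircle (n σ • embChar σ (Additive.ofMul x)) : Circle) : ℂ) = _
  rw [AddCircle.toCircle_zsmul, Circle.coe_zpow, toCircle_embChar]

theorem evalC_mul_conjugate (σ : F →+* ℂ) (x : maxCompact F) :
    evalC σ ((x : (FReal F)ˣ) : FReal F) *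
      evalC (ComplexEmbedding.conjugate σ) ((x : (FReal F)ˣ) : FReal F) = 1 := by
  rw [evalC_conjugate, Complex.mul_conj, Complex.normSq_eq_norm_sq, norm_evalC]
  simp

theorem sum_zsmul_embChar_eq_zero (m : InfinitePlace F → ℤ) :
    ∑ σ, (placeWeight (InfinitePlace.mk σ) * m (InfinitePlace.mk σ)) • embChar σ = 0 := by
  ext x
  refine toCircle_injective_coe ?_
  have h := toCircle_sum_zsmul_embChar
    (fun σ => placeWeight (InfinitePlace.mk σ) * m (InfinitePlace.mk σ)) x.toMul
  refine h.trans ?_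
  have hz : (0 : ContinuousAddMonoidHom (Additive (maxCompact F)) RmodZ) x = 0 := rfl
  rw [hz, AddCircle.toCircle_zero, Circle.coe_one]
  refine Finset.prod_involution (fun σ _ => ComplexEmbedding.conjugate σ) ?_ ?_
    (fun _ _ => Finset.mem_univ _) (fun σ _ => ComplexEmbedding.involutive_conjugate F σ)
  · intro σ _
    rw [InfinitePlace.mk_conjugate_eq, ← mul_zpow, evalC_mul_conjugate, one_zpow]
  · intro σ _ hne heq
    refine hne ?_
    have h2 := evalC_mul_conjugate σ x.toMul
    rw [heq, ← sq] at h2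
    rw [placeWeight, if_pos (InfinitePlace.isReal_mk_iff.2 (ComplexEmbedding.isReal_iff.2 heq)),
      zpow_mul]
    have h3 : ∀ z : ℂ, z ^ 2 = 1 → z ^ (2 : ℤ) = 1 := fun z hz => by exact_mod_cast hz
    rw [h3 _ h2, one_zpow]

theorem prod_eq_one_of_sum_zsmul_embChar_eq_zero {n : (F →+* ℂ) → ℤ}
    (h : ∑ σ, n σ • embChar σ = 0) (z : (F →+* ℂ) → ℂ) (hz : ∀ σ, ‖z σ‖ = 1)
    (hz' : ∀ σ, z (ComplexEmbedding.conjugate σ) = starRingEnd ℂ (z σ)) :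
    ∏ σ, z σ ^ n σ = 1 := by
  obtain ⟨x, hx⟩ := exists_maxCompact_evalC_eq z hz hz'
  have h1 := toCircle_sum_zsmul_embChar n x
  have hzero : (0 : ContinuousAddMonoidHom (Additive (maxCompact F)) RmodZ) (Additive.ofMul x) = 0 :=
    rfl
  rw [h, hzero, AddCircle.toCircle_zero, Circle.coe_one] at h1
  rw [h1]
  exact Finset.prod_congr rfl fun σ _ => by rw [hx]

theorem even_of_sum_zsmul_embChar_eq_zero {n : (F →+* ℂ) → ℤ}
    (h : ∑ σ, n σ • embChar σ = 0) {σ : F →+* ℂ} (hσ : ComplexEmbedding.IsReal σ) :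
    Even (n σ) := by
  classical
  have h1 := prod_eq_one_of_sum_zsmul_embChar_eq_zero h (Function.update 1 σ (-1))
    (fun τ => by by_cases hτ : τ = σ <;> simp [hτ])
    (fun τ => by
      have hiff : ComplexEmbedding.conjugate τ = σ ↔ τ = σ := by
        rw [(ComplexEmbedding.involutive_conjugate F).eq_iff, ComplexEmbedding.isReal_iff.1 hσ,
          eq_comm]
      by_cases hτ : τ = σ <;> simp [hτ, hiff,
        ComplexEmbedding.isReal_iff.1 hσ])
  rw [Finset.prod_eq_single σ (fun τ _ hτ => by simp [hτ]) (by simp),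
    Function.update_self] at h1
  by_contra hn
  rw [Int.not_even_iff_odd] at hn
  rw [hn.neg_one_zpow] at h1
  norm_num at h1

theorem eq_conjugate_of_sum_zsmul_embChar_eq_zero {n : (F →+* ℂ) → ℤ}
    (h : ∑ σ, n σ • embChar σ = 0) (σ : F →+* ℂ) :
    n (ComplexEmbedding.conjugate σ) = n σ := by
  classical
  by_contra hn
  have hσ : ComplexEmbedding.conjugate σ ≠ σ := fun h => hn (by rw [h])
  have hk : ((n σ - n (ComplexEmbedding.conjugate σ) : ℤ) : ℝ) ≠ 0 :=
    Int.cast_ne_zero.2 (sub_ne_zero.2 (Ne.symm hn))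
  obtain ⟨t, ht⟩ : ∃ t : Circle, t ^ (n σ - n (ComplexEmbedding.conjugate σ)) ≠ 1 := by
    refine ⟨Circle.exp (Real.pi / (n σ - n (ComplexEmbedding.conjugate σ) : ℤ)), ?_⟩
    rw [← Circle.exp_zsmul, zsmul_eq_mul, mul_div_cancel₀ _ hk]
    exact Circle.exp_pi_ne_one
  have h1 := prod_eq_one_of_sum_zsmul_embChar_eq_zero h
    (Function.update (Function.update 1 σ (t : ℂ)) (ComplexEmbedding.conjugate σ)
      (starRingEnd ℂ (t : ℂ)))
    (fun τ => by
      by_cases h1 : τ = ComplexEmbedding.conjugate σ <;> by_cases h2 : τ = σ <;>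
        simp [h1, h2, hσ.symm, Circle.norm_coe])
    (fun τ => by
      have hiff : ComplexEmbedding.conjugate τ = σ ↔ τ = ComplexEmbedding.conjugate σ := by
        rw [(ComplexEmbedding.involutive_conjugate F).eq_iff, eq_comm]
      have hiff' : ComplexEmbedding.conjugate τ = ComplexEmbedding.conjugate σ ↔ τ = σ :=
        (ComplexEmbedding.involutive_conjugate F).injective.eq_iff
      simp only [Function.update_apply, hiff, hiff']
      by_cases h1 : τ = ComplexEmbedding.conjugate σ
      · simp [h1, hσ]
      · by_cases h2 : τ = σ <;> simp [h1, h2, hσ.symm])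
  rw [Finset.prod_eq_mul σ (ComplexEmbedding.conjugate σ) hσ.symm
    (fun τ _ hτ => by simp [hτ.1, hτ.2]) (by simp) (by simp),
    Function.update_self, Function.update_of_ne hσ.symm, Function.update_self,
    ← Circle.coe_inv_eq_conj, ← Circle.coe_zpow, ← Circle.coe_zpow, ← Circle.coe_mul,
    inv_zpow, ← zpow_neg, ← zpow_add, ← sub_eq_add_neg] at h1
  exact ht (Circle.ext h1)

end characters

section embeddings

variable {K F G : Type} [Field K] [NumberField K] [Field F] [NumberField F] [Algebra K F]
  [IsGalois K F] [Group G] (iso : G ≃* (F ≃ₐ[K] F))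

/-- A choice of complex embeddings of `F`, one above each complex embedding of `K`. -/
noncomputable def baseEmb (K F : Type) [Field K] [NumberField K] [Field F] [NumberField F]
    [Algebra K F] [IsGalois K F] (i : Fin (Module.finrank ℚ K)) : F →+* ℂ :=
  ComplexEmbedding.lift F
    ((Fintype.equivFinOfCardEq (NumberField.Embeddings.card K ℂ)).symm i)

theorem baseEmb_comp_algebraMap (i : Fin (Module.finrank ℚ K)) :
    (baseEmb K F i).comp (algebraMap K F) =
      (Fintype.equivFinOfCardEq (NumberField.Embeddings.card K ℂ)).symm i :=
  ComplexEmbedding.lift_comp_algebraMap F _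

/-- The translate by `g` of a chosen complex embedding of `F`. -/
noncomputable def galEmb (p : Fin (Module.finrank ℚ K) × G) : F →+* ℂ :=
  (baseEmb K F p.1).comp ((iso p.2).symm : F →+* F)

theorem galEmb_comp_algebraMap (p : Fin (Module.finrank ℚ K) × G) :
    (galEmb iso p).comp (algebraMap K F) =
      (Fintype.equivFinOfCardEq (NumberField.Embeddings.card K ℂ)).symm p.1 := by
  rw [← baseEmb_comp_algebraMap (F := F)]
  ext x
  simp [galEmb]

theorem bijective_galEmb : Function.Bijective (galEmb iso) := by
  constructor
  · rintro ⟨i, g⟩ ⟨j, h⟩ e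
    have hij : i = j := by
      refine (Fintype.equivFinOfCardEq (NumberField.Embeddings.card K ℂ)).symm.injective ?_
      rw [← galEmb_comp_algebraMap iso (i, g), ← galEmb_comp_algebraMap iso (j, h), e]
    subst hij
    refine Prod.ext rfl (iso.injective ?_)
    have h2 : (iso g).symm = (iso h).symm :=
      AlgEquiv.ext fun x => (baseEmb K F i).injective (RingHom.congr_fun e x)
    rw [← (iso g).symm_symm, h2, AlgEquiv.symm_symm]
  · intro σ
    obtain ⟨i, hi⟩ := (Fintype.equivFinOfCardEq (NumberField.Embeddings.card K ℂ)).symm.surjective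
      (σ.comp (algebraMap K F))
    obtain ⟨g, hg⟩ := ComplexEmbedding.exists_comp_symm_eq_of_comp_eq (k := K) (baseEmb K F i) σ
      (by rw [baseEmb_comp_algebraMap, hi])
    obtain ⟨g, rfl⟩ := iso.surjective g
    exact ⟨(i, g), hg⟩

theorem smul_mk_galEmb (h : G) (i : Fin (Module.finrank ℚ K)) (g : G) :
    iso h • InfinitePlace.mk (galEmb iso (i, g)) = InfinitePlace.mk (galEmb iso (i, h * g)) := by
  rw [InfinitePlace.smul_mk]
  congr 1
  ext x
  simp only [galEmb, map_mul]
  rfl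

theorem sum_galEmb {M : Type} [AddCommMonoid M] [Fintype G] (f : (F →+* ℂ) → M) :
    ∑ i, ∑ g, f (galEmb iso (i, g)) = ∑ σ, f σ := by
  rw [← Fintype.sum_prod_type']
  exact Function.Bijective.sum_comp (bijective_galEmb iso) f

end embeddings

theorem map_smul_of_map_single_smul {G M N : Type} [Group G] [AddCommGroup M] [AddCommGroup N]
    [Module (MonoidAlgebra ℤ G) M] [Module (MonoidAlgebra ℤ G) N] (f : M →+ N)
    (h : ∀ (g : G) (x : M), f (MonoidAlgebra.single g (1 : ℤ) • x) =
      MonoidAlgebra.single g (1 : ℤ) • f x) (a : MonoidAlgebra ℤ G) (x : M) :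
    f (a • x) = a • f x := by
  induction a using MonoidAlgebra.induction_linear with
  | zero => simp
  | add a b ha hb => rw [add_smul, map_add, ha, hb, add_smul]
  | single g n =>
    have hn : (MonoidAlgebra.single g n : MonoidAlgebra ℤ G) =
        n • MonoidAlgebra.single g (1 : ℤ) := by simp
    rw [hn, smul_assoc, smul_assoc, map_zsmul, h]

theorem single_smul_embChar {K F G : Type} [Field K] [NumberField K] [Field F] [NumberField F]
    [Algebra K F] [Group G] {iso : G ≃* (F ≃ₐ[K] F)}
    [Module (MonoidAlgebra ℤ G) (ContinuousAddMonoidHom (Additive (maxCompact F)) RmodZ)]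
    (hmD : ∀ (g : G) (φ : ContinuousAddMonoidHom (Additive (maxCompact F)) RmodZ)
      (x y : maxCompact F),
      ((y : (FReal F)ˣ) : FReal F) = galFReal K (iso g⁻¹) ((x : (FReal F)ˣ) : FReal F) →
      ((MonoidAlgebra.single g (1 : ℤ) : MonoidAlgebra ℤ G) • φ) (Additive.ofMul x) =
        φ (Additive.ofMul y))
    (g : G) (σ : F →+* ℂ) :
    (MonoidAlgebra.single g (1 : ℤ) : MonoidAlgebra ℤ G) • embChar σ =
      embChar (σ.comp ((iso g).symm : F →+* F)) := by
  ext x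
  let y : (FReal F)ˣ := Units.map (galFReal K (iso g⁻¹)).toAlgHom.toMonoidHom (x.toMul : (FReal F)ˣ)
  have hy : y ∈ maxCompact F := by
    rw [maxCompact_eq]
    intro τ
    change ‖evalC τ (galFReal K (iso g⁻¹) ((x.toMul : (FReal F)ˣ) : FReal F))‖ = 1
    rw [evalC_galFReal, norm_evalC]
  refine (hmD g (embChar σ) x.toMul ⟨y, hy⟩ rfl).trans (toCircle_injective_coe ?_)
  refine (toCircle_embChar σ _).trans (.trans ?_ (toCircle_embChar _ x.toMul).symm)
  change evalC σ (galFReal K (iso g⁻¹) ((x.toMul : (FReal F)ˣ) : FReal F)) = _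
  rw [evalC_galFReal, map_inv, AlgEquiv.aut_inv]

section exactSequence

variable {K F G : Type} [Field K] [NumberField K] [Field F] [NumberField F] [Algebra K F]
  [IsGalois K F] [Group G] {iso : G ≃* (F ≃ₐ[K] F)}

/-- The embedding of `ℤ[S∞]` into a free module whose quotient is the dual of `comp(F_ℝˣ)`. -/
noncomputable def placeMap [Fintype G]
    [Module (MonoidAlgebra ℤ G) (InfinitePlace F →₀ ℤ)]
    (hmS : ∀ (g : G) (x : InfinitePlace F →₀ ℤ),
      (MonoidAlgebra.single g (1 : ℤ) : MonoidAlgebra ℤ G) • x =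
        Finsupp.mapDomain (fun w => iso g • w) x) :
    (InfinitePlace F →₀ ℤ) →ₗ[MonoidAlgebra ℤ G]
      (Fin (Module.finrank ℚ K) → MonoidAlgebra ℤ G) :=
  let f : (InfinitePlace F →₀ ℤ) →+ (Fin (Module.finrank ℚ K) → MonoidAlgebra ℤ G) :=
    { toFun := fun m i => .ofCoeff (Finsupp.equivFunOnFinite.symm fun g =>
        placeWeight (InfinitePlace.mk (galEmb iso (i, g))) *
          m (InfinitePlace.mk (galEmb iso (i, g))))
      map_zero' := by
        ext i g
        simp
      map_add' := fun m n => by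
        ext i g
        simp [mul_add] }
  { f with
    map_smul' := map_smul_of_map_single_smul f fun h m => by
      ext i g
      have hmk : InfinitePlace.mk (galEmb iso (i, g)) =
          iso h • InfinitePlace.mk (galEmb iso (i, h⁻¹ * g)) := by
        rw [smul_mk_galEmb, mul_inv_cancel_left]
      have hw : placeWeight (InfinitePlace.mk (galEmb iso (i, g))) =
          placeWeight (InfinitePlace.mk (galEmb iso (i, h⁻¹ * g))) := by
        rw [hmk, placeWeight_smul]
      change placeWeight (InfinitePlace.mk (galEmb iso (i, g))) *
          (MonoidAlgebra.single h (1 : ℤ) • m) (InfinitePlace.mk (galEmb iso (i, g))) =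
        (MonoidAlgebra.single h 1 * f m i).coeff g
      rw [MonoidAlgebra.coeff_single_mul_apply, one_mul, hmS, hw, hmk,
        Finsupp.mapDomain_apply (MulAction.injective (iso h))]
      rfl }

variable [Fintype G]

theorem coeff_placeMap [Module (MonoidAlgebra ℤ G) (InfinitePlace F →₀ ℤ)]
    (hmS : ∀ (g : G) (x : InfinitePlace F →₀ ℤ),
      (MonoidAlgebra.single g (1 : ℤ) : MonoidAlgebra ℤ G) • x =
        Finsupp.mapDomain (fun w => iso g • w) x)
    (m : InfinitePlace F →₀ ℤ) (i : Fin (Module.finrank ℚ K)) (g : G) :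
    (placeMap hmS m i).coeff g = placeWeight (InfinitePlace.mk (galEmb iso (i, g))) *
      m (InfinitePlace.mk (galEmb iso (i, g))) :=
  rfl

theorem injective_placeMap [Module (MonoidAlgebra ℤ G) (InfinitePlace F →₀ ℤ)]
    (hmS : ∀ (g : G) (x : InfinitePlace F →₀ ℤ),
      (MonoidAlgebra.single g (1 : ℤ) : MonoidAlgebra ℤ G) • x =
        Finsupp.mapDomain (fun w => iso g • w) x) :
    Function.Injective (placeMap hmS) := by
  refine (injective_iff_map_eq_zero _).2 fun m hm => Finsupp.ext fun w => ?_
  obtain ⟨⟨i, g⟩, hp⟩ := (bijective_galEmb iso).2 w.embedding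
  have h : (placeMap hmS m i).coeff g = 0 := by rw [hm]; rfl
  rw [coeff_placeMap, hp, InfinitePlace.mk_embedding] at h
  exact (mul_eq_zero.1 h).resolve_left (placeWeight_ne_zero w)

theorem linearCombination_embChar
    [Module (MonoidAlgebra ℤ G) (ContinuousAddMonoidHom (Additive (maxCompact F)) RmodZ)]
    (hmD : ∀ (g : G) (φ : ContinuousAddMonoidHom (Additive (maxCompact F)) RmodZ)
      (x y : maxCompact F),
      ((y : (FReal F)ˣ) : FReal F) = galFReal K (iso g⁻¹) ((x : (FReal F)ˣ) : FReal F) →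
      ((MonoidAlgebra.single g (1 : ℤ) : MonoidAlgebra ℤ G) • φ) (Additive.ofMul x) =
        φ (Additive.ofMul y))
    {a : Fin (Module.finrank ℚ K) → MonoidAlgebra ℤ G} {n : (F →+* ℂ) → ℤ}
    (h : ∀ i g, (a i).coeff g = n (galEmb iso (i, g))) :
    Fintype.linearCombination (MonoidAlgebra ℤ G) (fun i => embChar (baseEmb K F i)) a =
      ∑ σ, n σ • embChar σ := by
  rw [Fintype.linearCombination_apply, ← sum_galEmb iso]
  refine Finset.sum_congr rfl fun i _ => ?_
  have ha : a i = ∑ g, (a i).coeff g • MonoidAlgebra.single g (1 : ℤ) := by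
    conv_lhs => rw [← MonoidAlgebra.sum_coeff_single (a i)]
    rw [Finsupp.sum_fintype _ _ (fun _ => MonoidAlgebra.single_zero _)]
    simp
  rw [ha, Finset.sum_smul]
  refine Finset.sum_congr rfl fun g _ => ?_
  rw [smul_assoc, single_smul_embChar hmD, h]
  rfl

theorem exists_coeff_eq (n : (F →+* ℂ) → ℤ) :
    ∃ a : Fin (Module.finrank ℚ K) → MonoidAlgebra ℤ G,
      ∀ i g, (a i).coeff g = n (galEmb iso (i, g)) :=
  ⟨fun i => .ofCoeff (Finsupp.equivFunOnFinite.symm fun g => n (galEmb iso (i, g))),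
    fun _ _ => rfl⟩

theorem surjective_linearCombination_embChar
    [Module (MonoidAlgebra ℤ G) (ContinuousAddMonoidHom (Additive (maxCompact F)) RmodZ)]
    (hmD : ∀ (g : G) (φ : ContinuousAddMonoidHom (Additive (maxCompact F)) RmodZ)
      (x y : maxCompact F),
      ((y : (FReal F)ˣ) : FReal F) = galFReal K (iso g⁻¹) ((x : (FReal F)ˣ) : FReal F) →
      ((MonoidAlgebra.single g (1 : ℤ) : MonoidAlgebra ℤ G) • φ) (Additive.ofMul x) =
        φ (Additive.ofMul y)) :
    Function.Surjective (Fintype.linearCombination (MonoidAlgebra ℤ G)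
      (fun i => embChar (baseEmb K F i))) := by
  classical
  refine mem_of_embChar_mem (LinearMap.range (Fintype.linearCombination (MonoidAlgebra ℤ G)
    (fun i => embChar (baseEmb K F i)))).toAddSubgroup fun σ => ?_
  obtain ⟨a, ha⟩ := exists_coeff_eq (iso := iso) (Pi.single σ 1)
  refine ⟨a, (linearCombination_embChar hmD ha).trans ?_⟩
  rw [Finset.sum_eq_single σ (fun τ _ hτ => by rw [Pi.single_eq_of_ne hτ]; exact zero_zsmul _) (by simp),
    Pi.single_eq_same]
  exact one_zsmul _

theorem exists_eq_placeWeight_mul {n : (F →+* ℂ) → ℤ} (h : ∑ σ, n σ • embChar σ = 0) :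
    ∃ m : InfinitePlace F →₀ ℤ, ∀ σ,
      n σ = placeWeight (InfinitePlace.mk σ) * m (InfinitePlace.mk σ) := by
  classical
  refine ⟨Finsupp.equivFunOnFinite.symm fun w =>
    if w.IsReal then n w.embedding / 2 else n w.embedding, fun σ => ?_⟩
  have hn : n (InfinitePlace.mk σ).embedding = n σ := by
    rcases InfinitePlace.embedding_mk_eq σ with e | e <;> rw [e]
    exact eq_conjugate_of_sum_zsmul_embChar_eq_zero h σ
  rw [Finsupp.equivFunOnFinite_symm_apply_apply, placeWeight, hn]
  split_ifs with hσ
  · exact (Int.mul_ediv_cancel' (even_of_sum_zsmul_embChar_eq_zero h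
      (InfinitePlace.isReal_mk_iff.1 hσ)).two_dvd).symm
  · rw [one_mul]

theorem exact_placeMap_linearCombination_embChar
    [Module (MonoidAlgebra ℤ G) (ContinuousAddMonoidHom (Additive (maxCompact F)) RmodZ)]
    (hmD : ∀ (g : G) (φ : ContinuousAddMonoidHom (Additive (maxCompact F)) RmodZ)
      (x y : maxCompact F),
      ((y : (FReal F)ˣ) : FReal F) = galFReal K (iso g⁻¹) ((x : (FReal F)ˣ) : FReal F) →
      ((MonoidAlgebra.single g (1 : ℤ) : MonoidAlgebra ℤ G) • φ) (Additive.ofMul x) =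
        φ (Additive.ofMul y))
    [Module (MonoidAlgebra ℤ G) (InfinitePlace F →₀ ℤ)]
    (hmS : ∀ (g : G) (x : InfinitePlace F →₀ ℤ),
      (MonoidAlgebra.single g (1 : ℤ) : MonoidAlgebra ℤ G) • x =
        Finsupp.mapDomain (fun w => iso g • w) x) :
    Function.Exact (placeMap hmS) (Fintype.linearCombination (MonoidAlgebra ℤ G)
      (fun i => embChar (baseEmb K F i))) := by
  intro a
  constructor
  · intro ha
    let e := Equiv.ofBijective _ (bijective_galEmb iso)
    obtain ⟨n, hn⟩ : ∃ n : (F →+* ℂ) → ℤ, ∀ i g, (a i).coeff g = n (galEmb iso (i, g)) := by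
      refine ⟨fun σ => (a (e.symm σ).1).coeff (e.symm σ).2, fun i g => ?_⟩
      have he : e.symm (galEmb iso (i, g)) = (i, g) := e.symm_apply_apply (i, g)
      simp only [he]
    rw [linearCombination_embChar hmD hn] at ha
    obtain ⟨m, hm⟩ := exists_eq_placeWeight_mul ha
    refine ⟨m, ?_⟩
    ext i g
    rw [coeff_placeMap, hn, hm]
  · rintro ⟨m, rfl⟩
    rw [linearCombination_embChar hmD (n := fun σ =>
      placeWeight (InfinitePlace.mk σ) * m (InfinitePlace.mk σ)) fun i g => coeff_placeMap hmS m i g]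
    exact sum_zsmul_embChar_eq_zero m

end exactSequence

/-!
STATEMENT 6: Let F/K be a finite Galois extension of number fields with Galois group G,
let S∞ be the set of archimedean places of F, and let d be the degree of K over ℚ.
Then [Hom_cts(comp(F_ℝˣ), ℝ/ℤ)] = d·[ℤ[G]] − [ℤ[S∞]] in G₀(ℤ[G]).

Here comp(F_ℝˣ) is the maximal compact subgroup of F_ℝˣ (the subgroup generated by all
compact subgroups), its Pontryagin dual Hom_cts(−, ℝ/ℤ) is a ℤ[G]-module via the
involution g ↦ g⁻¹, with module structure universally quantified and pinned down by a
pointwise characterization, and ℤ[S∞] is the permutation module on the archimedean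
places of F.
-/
theorem stmt6
    (K F : Type) [Field K] [NumberField K] [Field F] [NumberField F] [Algebra K F]
    [IsGalois K F] (G : Type) [Group G] (iso : G ≃* (F ≃ₐ[K] F))
    -- the ℤ[G]-module structure on the Pontryagin dual of comp(F_ℝˣ)
    [mD : Module (MonoidAlgebra ℤ G) (ContinuousAddMonoidHom (Additive (maxCompact F)) RmodZ)]
    (hmD : ∀ (g : G) (φ : ContinuousAddMonoidHom (Additive (maxCompact F)) RmodZ) (x y : maxCompact F),
      ((y : (FReal F)ˣ) : FReal F) = galFReal K (iso g⁻¹) ((x : (FReal F)ˣ) : FReal F) →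
      ((MonoidAlgebra.single g (1 : ℤ) : MonoidAlgebra ℤ G) • φ) (Additive.ofMul x) =
        φ (Additive.ofMul y))
    -- the permutation ℤ[G]-module ℤ[S∞] on the set of archimedean places of F
    [mS : Module (MonoidAlgebra ℤ G) (NumberField.InfinitePlace F →₀ ℤ)]
    (hmS : ∀ (g : G) (x : NumberField.InfinitePlace F →₀ ℤ),
      (MonoidAlgebra.single g (1 : ℤ) : MonoidAlgebra ℤ G) • x =
        Finsupp.mapDomain (fun w => iso g • w) x)
 :
    G0.cls (MonoidAlgebra ℤ G) (ContinuousAddMonoidHom (Additive (maxCompact F)) RmodZ) =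
      (Module.finrank ℚ K) • G0.cls (MonoidAlgebra ℤ G) (MonoidAlgebra ℤ G) -
        G0.cls (MonoidAlgebra ℤ G) (NumberField.InfinitePlace F →₀ ℤ) := by
  have : Module.Finite K F := Module.Finite.of_restrictScalars_finite ℚ K F
  have : Finite G := Finite.of_injective _ iso.injective
  have := Fintype.ofFinite G
  have hsurj := surjective_linearCombination_embChar hmD
  have : Module.Finite (MonoidAlgebra ℤ G)
      (ContinuousAddMonoidHom (Additive (maxCompact F)) RmodZ) :=
    Module.Finite.of_surjective _ hsurj
  have : IsScalarTower ℤ (MonoidAlgebra ℤ G) (InfinitePlace F →₀ ℤ) :=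
    AddCommGroup.intIsScalarTower
  have : Module.Finite (MonoidAlgebra ℤ G) (InfinitePlace F →₀ ℤ) :=
    Module.Finite.of_restrictScalars_finite ℤ (MonoidAlgebra ℤ G) (InfinitePlace F →₀ ℤ)
  rw [← G0.cls_fin_fun, G0.cls_of_exact (placeMap hmS) _ (injective_placeMap hmS) hsurj
    (exact_placeMap_linearCombination_embChar hmD hmS), add_sub_cancel_left]
end
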